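/- Let n, m, k be positive integers. Let Ψ be a real m×n matrix and φ a real orthogonal n×n matrix, and set Θ = Ψ·φ. Suppose Θ satisfies the restricted isometry property of order 2k with constant δ < √2 − 1, i.e., (1−δ)‖s‖₂² ≤ ‖Θ·s‖₂² ≤ (1+δ)‖s‖₂² for every s ∈ ℝⁿ with at most 2k nonzero entries. Let s₀ ∈ ℝⁿ have at most k nonzero entries, let x = φ·s₀, let ε ≥ 0, and let z = Ψ·x + η where ‖η‖₂ ≤ ε. Let ŝ ∈ ℝⁿ be any minimizer of the ℓ1-norm over the feasible set {s' ∈ ℝⁿ : ‖z − Θ·s'‖₂ ≤ ε} (i.e., ‖z − Θ·ŝ‖₂ ≤ ε and ‖ŝ‖₁ ≤ ‖s'‖₁ for every feasible s'), and set x̂ = φ·ŝ. Then ‖x − x̂‖₂ ≤ c₁·ε, where c₁ = 4·√(1+δ) / (1 − (1+√2)·δ). -/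

import Mathlib

open scoped Matrix

lemma my_le_of_sq {a b : ℝ} (h : a ^ 2 ≤ b ^ 2) (hb : 0 ≤ b) : a ≤ b := by
  by_contra hc
  push Not at hc
  nlinarith

lemma top_aux {ι : Type*} [DecidableEq ι] (h : ι → ℝ) (S : Finset ι) (k : ℕ) (hk : k ≤ S.card) :
    ∃ T ⊆ S, T.card = k ∧ ∀ i ∈ T, ∀ j ∈ S \ T, |h j| ≤ |h i| := by
  induction k with
  | zero => exact ⟨∅, by simp, by simp, by simp⟩
  | succ k ih =>
    obtain ⟨T, hTS, hc, hT⟩ := ih (by omega)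
    have hne : (S \ T).Nonempty := by
      rw [← Finset.card_pos, Finset.card_sdiff_of_subset hTS]; omega
    obtain ⟨a, ha, hmax⟩ := Finset.exists_max_image (S \ T) (fun i => |h i|) hne
    have ha' := Finset.mem_sdiff.1 ha
    refine ⟨insert a T, ?_, ?_, ?_⟩
    · exact Finset.insert_subset ha'.1 hTS
    · rw [Finset.card_insert_of_notMem ha'.2, hc]
    · intro i hi j hj
      have hj' : j ∈ S \ T := by
        simp only [Finset.mem_sdiff, Finset.mem_insert, not_or] at hj ⊢
        exact ⟨hj.1, hj.2.2⟩
      rcases Finset.mem_insert.1 hi with rfl | hi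
      · exact hmax j hj'
      · exact hT i hi j hj'

lemma top_block {ι : Type*} [DecidableEq ι] (h : ι → ℝ) (S : Finset ι) (k : ℕ) (hk : 0 < k) :
    ∃ T ⊆ S, T.card ≤ k ∧ (S.Nonempty → T.Nonempty) ∧ ∃ M : ℝ, 0 ≤ M ∧
      (∀ j ∈ S \ T, |h j| ≤ M) ∧ k * M ≤ ∑ i ∈ T, |h i| := by
  by_cases hS : k ≤ S.card
  · obtain ⟨T, hTS, hc, hT⟩ := top_aux h S k hS
    have hne : T.Nonempty := by rw [← Finset.card_pos]; omega
    obtain ⟨a, ha, hmin⟩ := Finset.exists_min_image T (fun i => |h i|) hne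
    refine ⟨T, hTS, hc.le, fun _ => hne, |h a|, abs_nonneg _, fun j hj => hT a ha j hj, ?_⟩
    have := Finset.card_nsmul_le_sum T (fun i => |h i|) (|h a|) hmin
    rw [hc] at this
    simpa using this
  · refine ⟨S, subset_rfl, by omega, id, 0, le_rfl, by simp, ?_⟩
    simpa using Finset.sum_nonneg fun i _ => abs_nonneg (h i)

/-- restriction of a vector to a set of coordinates -/
noncomputable def rstr {n : ℕ} (h : EuclideanSpace ℝ (Fin n)) (T : Finset (Fin n)) :
    EuclideanSpace ℝ (Fin n) := WithLp.toLp 2 fun i => if i ∈ T then h i else 0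

lemma rstr_union {n : ℕ} (h : EuclideanSpace ℝ (Fin n)) (S T : Finset (Fin n))
    (hd : Disjoint S T) : rstr h (S ∪ T) = rstr h S + rstr h T := by
  ext i
  have := fun hi => Finset.disjoint_left.1 hd (show i ∈ S from hi)
  by_cases h1 : i ∈ S <;> by_cases h2 : i ∈ T <;> simp_all [rstr]

lemma rstr_sq {n : ℕ} (h : EuclideanSpace ℝ (Fin n)) (T : Finset (Fin n)) :
    ‖rstr h T‖ ^ 2 = ∑ i ∈ T, h i ^ 2 := by
  rw [EuclideanSpace.norm_sq_eq]
  simp [rstr, ite_pow, Finset.sum_ite_mem]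

lemma rstr_le {n : ℕ} (h : EuclideanSpace ℝ (Fin n)) (T : Finset (Fin n)) (k : ℕ)
    (hT : T.card ≤ k) (M : ℝ) (hM : 0 ≤ M) (hb : ∀ j ∈ T, |h j| ≤ M) :
    ‖rstr h T‖ ≤ √k * M := by
  apply my_le_of_sq _ (by positivity)
  rw [rstr_sq, mul_pow, Real.sq_sqrt (by positivity)]
  calc ∑ i ∈ T, h i ^ 2 ≤ T.card • M ^ 2 := Finset.sum_le_card_nsmul _ _ _ fun i hi => by
        rw [← sq_abs]; exact pow_le_pow_left₀ (abs_nonneg _) (hb i hi) 2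
    _ ≤ k * M ^ 2 := by
        rw [nsmul_eq_mul]; gcongr

lemma block_bound {n : ℕ} (h : EuclideanSpace ℝ (Fin n)) (k : ℕ) (hk : 0 < k)
    (G : Finset (Fin n) → ℝ) (C : ℝ) (hC : 0 ≤ C) (U : Finset (Fin n))
    (hG : ∀ S T, Disjoint S T → G (S ∪ T) ≤ G S + G T)
    (hGC : ∀ T ⊆ U, T.card ≤ k → G T ≤ C * ‖rstr h T‖) :
    ∀ S ⊆ U, ∀ M : ℝ, 0 ≤ M → (∀ j ∈ S, |h j| ≤ M) →
      G S ≤ C * (√k * M + (∑ i ∈ S, |h i|) / √k) := by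
  intro S
  induction S using Finset.strongInduction with
  | H S ih =>
  intro hSU M hM hb
  have hr : 0 < √(k : ℝ) := by positivity
  rcases S.eq_empty_or_nonempty with rfl | hne
  · refine (hGC ∅ (by simp) (by simp)).trans ?_
    have := rstr_le h ∅ k (by simp) M hM hb
    gcongr
    simpa using this
  · obtain ⟨T, hTS, hc, hTne, M', hM', hb', hs⟩ := top_block h S k hk
    have h1 := hG T (S \ T) Finset.disjoint_sdiff
    rw [Finset.union_sdiff_of_subset hTS] at h1
    have h2 := hGC T (hTS.trans hSU) hc
    have h3 := rstr_le h T k hc M hM (fun j hj => hb j (hTS hj))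
    have h4 := ih (S \ T) (Finset.sdiff_ssubset hTS (hTne hne)) (Finset.sdiff_subset.trans hSU)
      M' hM' hb'
    have h5 : √k * M' ≤ (∑ i ∈ T, |h i|) / √k := by
      rw [le_div_iff₀ hr]
      calc √k * M' * √k = (√k * √k) * M' := by ring
        _ = k * M' := by rw [Real.mul_self_sqrt (by positivity)]
        _ ≤ _ := hs
    have h6 : (∑ i ∈ S, |h i|) = (∑ i ∈ T, |h i|) + ∑ i ∈ S \ T, |h i| := by
      rw [add_comm, Finset.sum_sdiff hTS]
    rw [h6, add_div]
    have h7 : C * (√k * M' + (∑ i ∈ S \ T, |h i|) / √k) + C * ‖rstr h T‖ ≤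
      C * (√k * M + ((∑ i ∈ T, |h i|) / √k + (∑ i ∈ S \ T, |h i|) / √k)) := by
      rw [← mul_add]; refine mul_le_mul_of_nonneg_left ?_ hC; linarith
    linarith

def Sparse {n : ℕ} (k : ℕ) (s : EuclideanSpace ℝ (Fin n)) : Prop :=
  ∃ T : Finset (Fin n), T.card ≤ k ∧ ∀ i ∉ T, s i = 0

lemma rip_inner {n : ℕ} {F : Type*} [NormedAddCommGroup F] [InnerProductSpace ℝ F]
    (A : EuclideanSpace ℝ (Fin n) →ₗ[ℝ] F) (δ : ℝ) (k : ℕ)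
    (hR : ∀ s, Sparse (2 * k) s → (1 - δ) * ‖s‖ ^ 2 ≤ ‖A s‖ ^ 2 ∧ ‖A s‖ ^ 2 ≤ (1 + δ) * ‖s‖ ^ 2)
    (h : EuclideanSpace ℝ (Fin n)) (S T : Finset (Fin n)) (hd : Disjoint S T) (hS : S.card ≤ k)
    (hT : T.card ≤ k) (c : ℝ) (hc : |c| = 1) :
    c * inner ℝ (A (rstr h S)) (A (rstr h T)) ≤ δ * ‖rstr h S‖ * ‖rstr h T‖ := by
  set u := rstr h S with hu
  set v := rstr h T with hv
  by_cases hu0 : u = 0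
  · simp [hu0]
  by_cases hv0 : v = 0
  · simp [hv0]
  have ha : 0 < ‖u‖ := norm_pos_iff.2 hu0
  have hb : 0 < ‖v‖ := norm_pos_iff.2 hv0
  have hsp : ∀ a b : ℝ, Sparse (2 * k) (a • u + b • v) := by
    intro a b
    refine ⟨S ∪ T, (Finset.card_union_le _ _).trans (by omega), ?_⟩
    intro i hi
    simp only [Finset.mem_union, not_or] at hi
    simp [hu, hv, rstr, hi.1, hi.2]
  have huv : inner ℝ u v = 0 := by
    rw [PiLp.inner_apply]
    apply Finset.sum_eq_zero
    intro i _
    have := fun hi => Finset.disjoint_left.1 hd (show i ∈ S from hi)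
    by_cases h1 : i ∈ S <;> by_cases h2 : i ∈ T <;> simp_all [rstr]
  have h1 := (hR _ (hsp ‖v‖ (c * ‖u‖))).2
  have h2 := (hR _ (hsp ‖v‖ (-(c * ‖u‖)))).1
  have hc2 : c ^ 2 = 1 := by rw [← sq_abs, hc]; norm_num
  simp only [map_add, map_smul, norm_add_sq_real, inner_smul_left, inner_smul_right, huv,
    norm_smul, mul_pow, Real.norm_eq_abs, sq_abs, neg_sq, hc2, conj_trivial] at h1 h2
  have h3 : (‖u‖ * ‖v‖) * (c * inner ℝ (A u) (A v)) ≤ (‖u‖ * ‖v‖) * (δ * ‖u‖ * ‖v‖) := by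
    nlinarith
  exact le_of_mul_le_mul_left h3 (by positivity)

lemma core {n : ℕ} {F : Type*} [NormedAddCommGroup F] [InnerProductSpace ℝ F]
    (A : EuclideanSpace ℝ (Fin n) →ₗ[ℝ] F) (δ : ℝ) (hδ : 0 ≤ δ) (k : ℕ) (hk : 0 < k)
    (hδ1 : 0 < 1 - (1 + √2) * δ)
    (hR : ∀ s, Sparse (2 * k) s → (1 - δ) * ‖s‖ ^ 2 ≤ ‖A s‖ ^ 2 ∧ ‖A s‖ ^ 2 ≤ (1 + δ) * ‖s‖ ^ 2)
    (h : EuclideanSpace ℝ (Fin n)) (T₀ : Finset (Fin n)) (hT₀ : T₀.card ≤ k)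
    (hcone : ∑ i ∈ T₀ᶜ, |h i| ≤ ∑ i ∈ T₀, |h i|) (ε : ℝ) (hA : ‖A h‖ ≤ 2 * ε) :
    (1 - (1 + √2) * δ) * ‖h‖ ≤ 4 * √(1 + δ) * ε := by
  obtain ⟨T₁, hT₁, hc, -, M, hM, hb, hs⟩ := top_block h T₀ᶜ k hk
  have hr : 0 < √(k : ℝ) := by positivity
  set U := T₀ᶜ \ T₁ with hU
  have hd01 : Disjoint T₀ T₁ := by
    rw [Finset.disjoint_left]; intro a ha hb
    exact (Finset.mem_compl.1 (hT₁ hb)) ha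
  have hd0 : Disjoint T₀ U := by
    rw [Finset.disjoint_left]; intro a ha hb
    simp [hU, ha] at hb
  have hd1 : Disjoint T₁ U := Finset.disjoint_sdiff
  set u := rstr h T₀ with hu
  set v := rstr h T₁ with hv
  set w := rstr h U with hw
  have hw1 : √k * M + (∑ i ∈ U, |h i|) / √k ≤ ‖u‖ := by
    have h1 : √k * M ≤ (∑ i ∈ T₁, |h i|) / √k := by
      rw [le_div_iff₀ hr]
      calc √k * M * √k = (√k * √k) * M := by ring
        _ = k * M := by rw [Real.mul_self_sqrt (by positivity)]
        _ ≤ _ := hs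
    have h2 : (∑ i ∈ U, |h i|) + ∑ i ∈ T₁, |h i| = ∑ i ∈ T₀ᶜ, |h i| := Finset.sum_sdiff hT₁
    have h3 : ∑ i ∈ T₀, |h i| ≤ √k * ‖u‖ := by
      apply my_le_of_sq _ (by positivity)
      rw [mul_pow, Real.sq_sqrt (by positivity), rstr_sq]
      refine sq_sum_le_card_mul_sum_sq.trans ?_
      simp only [sq_abs]
      have : 0 ≤ ∑ i ∈ T₀, h i ^ 2 := Finset.sum_nonneg fun i _ => sq_nonneg _
      gcongr
    calc _ ≤ (∑ i ∈ T₁, |h i|) / √k + (∑ i ∈ U, |h i|) / √k := by gcongr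
      _ = (∑ i ∈ T₀ᶜ, |h i|) / √k := by rw [← h2]; ring
      _ ≤ ‖u‖ := by rw [div_le_iff₀ hr]; linarith
  have hwn : ‖w‖ ≤ ‖u‖ := by
    have := block_bound h k hk (fun S => ‖rstr h S‖) 1 zero_le_one U
      (fun S T hd => by simp only [rstr_union h S T hd]; exact norm_add_le _ _)
      (fun T _ _ => by simp) U subset_rfl M hM hb
    simp only [one_mul] at this
    exact this.trans hw1
  have key : ∀ T : Finset (Fin n), T.card ≤ k → Disjoint T U →
      -inner ℝ (A (rstr h T)) (A w) ≤ δ * ‖rstr h T‖ * ‖u‖ := by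
    intro T hT hTU
    have := block_bound h k hk (fun S => -inner ℝ (A (rstr h T)) (A (rstr h S)))
      (δ * ‖rstr h T‖) (by positivity) U
      (fun S T hd => by simp only [rstr_union h S T hd, map_add, inner_add_right]; linarith)
      (fun S hS hSc => by
        have := rip_inner A δ k hR h T S (hTU.mono_right hS) hT hSc (-1) (by simp)
        linarith) U subset_rfl M hM hb
    refine this.trans ?_
    gcongr
  have k0 := key T₀ hT₀ hd0
  have k1 := key T₁ hc hd1
  rw [← hu] at k0
  rw [← hv] at k1
  have hh : h = (u + v) + w := by
    rw [hu, hv, hw, ← rstr_union h _ _ hd01, ← rstr_union h _ _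
      (Finset.disjoint_union_left.2 ⟨hd0, hd1⟩)]
    ext i
    have : i ∈ T₀ ∪ T₁ ∪ U := by
      simp only [hU, Finset.mem_union, Finset.mem_sdiff, Finset.mem_compl]; tauto
    simp only [rstr, this, if_true]
  have hp2 : ‖u + v‖ ^ 2 = ‖u‖ ^ 2 + ‖v‖ ^ 2 := by
    rw [hu, hv, ← rstr_union h _ _ hd01, rstr_sq, rstr_sq, rstr_sq, Finset.sum_union hd01]
  set p := u + v with hp
  have hup : ‖u‖ ≤ ‖p‖ := my_le_of_sq (by nlinarith [sq_nonneg ‖v‖]) (norm_nonneg _)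
  have huv : ‖u‖ + ‖v‖ ≤ √2 * ‖p‖ := by
    apply my_le_of_sq _ (by positivity)
    rw [mul_pow, Real.sq_sqrt (by norm_num), hp2]
    nlinarith [sq_nonneg (‖u‖ - ‖v‖)]
  have hps : Sparse (2 * k) p := by
    refine ⟨T₀ ∪ T₁, (Finset.card_union_le _ _).trans (by omega), ?_⟩
    intro i hi
    simp only [Finset.mem_union, not_or] at hi
    simp [hp, hu, hv, rstr, hi.1, hi.2]
  obtain ⟨hl, hup2⟩ := hR p hps
  have hAp : ‖A p‖ ≤ √(1 + δ) * ‖p‖ := by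
    apply my_le_of_sq _ (by positivity)
    rw [mul_pow, Real.sq_sqrt (by positivity)]; exact hup2
  have hin : ‖A p‖ ^ 2 = inner ℝ (A p) (A h) - inner ℝ (A u) (A w) - inner ℝ (A v) (A w) := by
    rw [hh, map_add A p w, inner_add_right, real_inner_self_eq_norm_sq, hp, map_add,
      inner_add_left (A u) (A v) (A w)]; ring
  have hcs : inner ℝ (A p) (A h) ≤ (√(1 + δ) * ‖p‖) * (2 * ε) :=
    (real_inner_le_norm _ _).trans (by gcongr)
  have hε : 0 ≤ ε := by linarith [norm_nonneg (A h)]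
  have hδu : δ * (‖u‖ + ‖v‖) * ‖u‖ ≤ δ * (√2 * ‖p‖) * ‖p‖ := by gcongr
  have hmain : ‖p‖ * ((1 - (1 + √2) * δ) * ‖p‖) ≤ ‖p‖ * (2 * √(1 + δ) * ε) := by
    nlinarith
  have hmain' : (1 - (1 + √2) * δ) * ‖p‖ ≤ 2 * √(1 + δ) * ε := by
    rcases (norm_nonneg p).eq_or_lt with h0 | h0
    · rw [← h0]; simp; positivity
    · exact le_of_mul_le_mul_left hmain h0
  have hn : ‖h‖ ≤ 2 * ‖p‖ := by
    have := norm_add_le p w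
    rw [← hh] at this; linarith
  have := mul_le_mul_of_nonneg_left hn hδ1.le
  linarith

/-- ℓ1-minimization recovery guarantee. If `Θ = Ψ·φ` (with `φ`
orthogonal) satisfies the RIP of order `2k` with constant `δ < √2 − 1`, `x = φ·s₀`
with `s₀` `k`-sparse, `z = Ψ·x + η` with `‖η‖₂ ≤ ε`, and `shat` minimizes the ℓ1-norm
over `{s' : ‖z − Θ·s'‖₂ ≤ ε}`, then `xhat = φ·shat` satisfies `‖x − xhat‖₂ ≤ c₁·ε` with
`c₁ = 4√(1+δ)/(1 − (1+√2)δ)`. -/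
theorem stmt_6 (n m k : ℕ) (hn : 0 < n) (hm : 0 < m) (hk : 0 < k)
    (Ψ : Matrix (Fin m) (Fin n) ℝ) (φ : Matrix (Fin n) (Fin n) ℝ)
    (hφ : φᵀ * φ = 1)
    (δ : ℝ) (hδ : δ < Real.sqrt 2 - 1)
    (Θ : Matrix (Fin m) (Fin n) ℝ) (hΘ : Θ = Ψ * φ)
    (hRIP : ∀ s : Fin n → ℝ,
      (Finset.univ.filter fun i => s i ≠ 0).card ≤ 2 * k →
      (1 - δ) * (∑ i, (s i) ^ 2) ≤ (∑ i, ((Θ *ᵥ s) i) ^ 2) ∧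
      (∑ i, ((Θ *ᵥ s) i) ^ 2) ≤ (1 + δ) * (∑ i, (s i) ^ 2))
    (s₀ : Fin n → ℝ) (hs₀ : (Finset.univ.filter fun i => s₀ i ≠ 0).card ≤ k)
    (x : Fin n → ℝ) (hx : x = φ *ᵥ s₀)
    (ε : ℝ) (hε : 0 ≤ ε)
    (η : Fin m → ℝ) (hη : Real.sqrt (∑ i, (η i) ^ 2) ≤ ε)
    (z : Fin m → ℝ) (hz : z = Ψ *ᵥ x + η)
    (shat : Fin n → ℝ)
    (hfeas : Real.sqrt (∑ i, ((z - Θ *ᵥ shat) i) ^ 2) ≤ ε)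
    (hmin : ∀ s' : Fin n → ℝ, Real.sqrt (∑ i, ((z - Θ *ᵥ s') i) ^ 2) ≤ ε →
      (∑ i, |shat i|) ≤ ∑ i, |s' i|)
    (xhat : Fin n → ℝ) (hxhat : xhat = φ *ᵥ shat) :
    Real.sqrt (∑ i, ((x - xhat) i) ^ 2) ≤
      (4 * Real.sqrt (1 + δ) / (1 - (1 + Real.sqrt 2) * δ)) * ε := by
  have hsq : ∀ {p : ℕ} (v : Fin p → ℝ), ‖(WithLp.toLp 2 v : EuclideanSpace ℝ (Fin p))‖ ^ 2
      = ∑ i, v i ^ 2 := by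
    intro p v; rw [EuclideanSpace.norm_sq_eq]; simp
  have hnm : ∀ {p : ℕ} (v : Fin p → ℝ), √(∑ i, v i ^ 2)
      = ‖(WithLp.toLp 2 v : EuclideanSpace ℝ (Fin p))‖ := by
    intro p v; rw [← hsq, Real.sqrt_sq (norm_nonneg _)]
  have h2 : √2 ^ 2 = (2 : ℝ) := Real.sq_sqrt (by norm_num)
  have h2p : 0 < √(2 : ℝ) := by positivity
  have hδ0 : 0 ≤ δ := by
    have := hRIP (Pi.single ⟨0, hn⟩ 1) (by
      refine (Finset.card_le_one.2 ?_).trans (by omega)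
      intro a ha b hb
      simp [Pi.single_apply] at ha hb
      rw [ha, hb])
    have h1 : ∑ i, (Pi.single (⟨0, hn⟩ : Fin n) (1 : ℝ) : Fin n → ℝ) i ^ 2 = 1 := by
      simp [Pi.single_apply]
    rw [h1] at this
    linarith [this.1, this.2]
  have hδ1 : 0 < 1 - (1 + √2) * δ := by nlinarith
  have hΘs : ∀ s, Ψ *ᵥ (φ *ᵥ s) = Θ *ᵥ s := by intro s; rw [hΘ, Matrix.mulVec_mulVec]
  set T₀ := Finset.univ.filter fun i => s₀ i ≠ 0 with hT₀
  have hz' : z - Θ *ᵥ s₀ = η := by rw [hz, hx, hΘs]; simp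
  have hl1 := hmin s₀ (by rw [hz']; exact hη)
  set h : Fin n → ℝ := s₀ - shat with hh
  have hcone : ∑ i ∈ T₀ᶜ, |h i| ≤ ∑ i ∈ T₀, |h i| := by
    rw [← Finset.sum_add_sum_compl T₀, ← Finset.sum_add_sum_compl T₀ (fun i => |s₀ i|)] at hl1
    have e0 : ∀ i ∈ T₀ᶜ, s₀ i = 0 := by intro i hi; simpa [hT₀] using hi
    have e1 : ∑ i ∈ T₀ᶜ, |s₀ i| = 0 := Finset.sum_eq_zero fun i hi => by simp [e0 i hi]
    have e2 : ∑ i ∈ T₀ᶜ, |h i| = ∑ i ∈ T₀ᶜ, |shat i| :=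
      Finset.sum_congr rfl fun i hi => by simp [hh, e0 i hi]
    have e3 : ∑ i ∈ T₀, |s₀ i| ≤ ∑ i ∈ T₀, |h i| + ∑ i ∈ T₀, |shat i| := by
      rw [← Finset.sum_add_distrib]
      refine Finset.sum_le_sum fun i _ => ?_
      have := abs_add_le (s₀ i - shat i) (shat i)
      simpa [hh] using this
    linarith
  have hAe : ∀ s : EuclideanSpace ℝ (Fin n), Matrix.toEuclideanLin Θ s
      = WithLp.toLp 2 (Θ *ᵥ (WithLp.ofLp s)) := fun s => rfl
  have hcore := core (Matrix.toEuclideanLin Θ) δ hδ0 k hk hδ1 (by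
    rintro s ⟨T, hT, hs⟩
    have hss : ‖s‖ ^ 2 = ∑ i, s i ^ 2 := hsq s.ofLp
    rw [hAe, hss, hsq]
    apply hRIP
    refine (Finset.card_le_card ?_).trans hT
    intro i hi
    by_contra hc
    simp [hs i hc] at hi) (WithLp.toLp 2 h) T₀ hs₀ hcone ε (by
    rw [hAe]
    have : Θ *ᵥ h = (z - Θ *ᵥ shat) - η := by
      rw [← hz', hh, Matrix.mulVec_sub]; abel
    simp only [this, WithLp.toLp_sub]
    rw [hnm] at hfeas hη
    rw [WithLp.toLp_sub] at hfeas
    refine (norm_sub_le _ _).trans (by linarith))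
  have hiso : ∑ i, ((x - xhat) i) ^ 2 = ∑ i, h i ^ 2 := by
    have e1 : x - xhat = φ *ᵥ h := by rw [hx, hxhat, hh, Matrix.mulVec_sub]
    have e2 : ∀ v : Fin n → ℝ, ∑ i, v i ^ 2 = v ⬝ᵥ v := by
      intro v; simp [dotProduct, sq]
    rw [e1, e2, e2, Matrix.dotProduct_mulVec, Matrix.vecMul_mulVec, ← Matrix.mulVec_transpose, ]
    simp [hφ]
  rw [hiso, hnm, div_mul_eq_mul_div, le_div_iff₀ hδ1]
  linarith
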